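/- Let w_ω denote the Weil element of the sl₂(ℂ)-representation on ⋀V* determined by the Lefschetz operator of a nondegenerate 2-form ω on a 2n-dimensional vector space V, and let ξ ∈ V with θ = −ι_ξ ω. Then for every α ∈ ⋀^{n−p}⊗-graded piece (total degree n−k, k = total codegree), w_ω(ι_ξ α) = θ ∧ w_ω(α). In particular, the Weil element w_ω exchanges contraction with ξ and wedge product with θ. -/

import Mathlib

open ExteriorAlgebra

/-- The `i`-th graded piece `⋀^i M` of the exterior algebra of `M`. -/
noncomputable def extGrade (M : Type*) [AddCommGroup M] [Module ℂ M] (i : ℕ) :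
    Submodule ℂ (ExteriorAlgebra ℂ M) :=
  (LinearMap.range (ExteriorAlgebra.ι ℂ : M →ₗ[ℂ] ExteriorAlgebra ℂ M)) ^ i

theorem aux_comm1 {M : Type*} [AddCommGroup M] [Module ℂ M] (a b : M)
    (x : ExteriorAlgebra ℂ M) :
    (ExteriorAlgebra.ι ℂ a * ExteriorAlgebra.ι ℂ b) * x
      = x * (ExteriorAlgebra.ι ℂ a * ExteriorAlgebra.ι ℂ b) := by
  have anti : ∀ u v : M, ExteriorAlgebra.ι ℂ u * ExteriorAlgebra.ι ℂ v
      = - (ExteriorAlgebra.ι ℂ v * ExteriorAlgebra.ι ℂ u) := fun u v =>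
    eq_neg_of_add_eq_zero_left (ExteriorAlgebra.ι_add_mul_swap u v)
  induction x using ExteriorAlgebra.induction with
  | algebraMap r => exact (Algebra.commutes r _).symm
  | ι c =>
    rw [mul_assoc, anti b c, mul_neg, ← mul_assoc, anti a c, neg_mul, neg_neg, mul_assoc]
  | mul x y hx hy => rw [← mul_assoc, hx, mul_assoc, hy, mul_assoc]
  | add x y hx hy => rw [mul_add, add_mul, hx, hy]

theorem aux_comm {M : Type*} [AddCommGroup M] [Module ℂ M]
    (ω : ExteriorAlgebra ℂ M) (hω : ω ∈ extGrade M 2) (x : ExteriorAlgebra ℂ M) :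
    ω * x = x * ω := by
  unfold extGrade at hω
  rw [pow_two] at hω
  induction hω using Submodule.mul_induction_on' with
  | mem_mul_mem m hm m' hm' =>
    obtain ⟨a, rfl⟩ := hm
    obtain ⟨b, rfl⟩ := hm'
    exact aux_comm1 a b x
  | add u _ v _ hu hv => rw [mul_add, add_mul, hu, hv]

theorem aux_leib {M : Type*} [AddCommGroup M] [Module ℂ M] (ξ : Module.Dual ℂ M)
    (ω : ExteriorAlgebra ℂ M) (hω : ω ∈ extGrade M 2) (x : ExteriorAlgebra ℂ M) :
    CliffordAlgebra.contractLeft ξ (ω * x)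
      = CliffordAlgebra.contractLeft ξ ω * x + ω * CliffordAlgebra.contractLeft ξ x := by
  unfold extGrade at hω
  rw [pow_two] at hω
  induction hω using Submodule.mul_induction_on' with
  | mem_mul_mem m hm m' hm' =>
    obtain ⟨a, rfl⟩ := hm
    obtain ⟨b, rfl⟩ := hm'
    rw [mul_assoc, CliffordAlgebra.contractLeft_ι_mul, CliffordAlgebra.contractLeft_ι_mul,
      CliffordAlgebra.contractLeft_ι_mul, CliffordAlgebra.contractLeft_ι, ← Algebra.commutes,
      ← Algebra.smul_def]
    simp only [mul_sub, sub_mul, smul_mul_assoc, mul_smul_comm, mul_assoc]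
    abel
  | add u _ v _ hu hv =>
    rw [add_mul, map_add, map_add, hu, hv, add_mul, add_mul]
    abel

theorem aux_leib_pow {M : Type*} [AddCommGroup M] [Module ℂ M] (ξ : Module.Dual ℂ M)
    (ω : ExteriorAlgebra ℂ M) (hω : ω ∈ extGrade M 2) (x : ExteriorAlgebra ℂ M) (j : ℕ) :
    CliffordAlgebra.contractLeft ξ (ω ^ (j + 1) * x)
      = ((j : ℂ) + 1) • (ω ^ j * (CliffordAlgebra.contractLeft ξ ω * x))
        + ω ^ (j + 1) * CliffordAlgebra.contractLeft ξ x := by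
  induction j with
  | zero => simp [aux_leib ξ ω hω]
  | succ j ih =>
    have hc : CliffordAlgebra.contractLeft ξ ω * (ω ^ (j + 1) * x)
        = ω ^ (j + 1) * (CliffordAlgebra.contractLeft ξ ω * x) := by
      rw [← mul_assoc, ← mul_assoc]
      congr 1
      exact ((show Commute ω _ from aux_comm ω hω _).pow_left (j + 1)).eq.symm
    rw [pow_succ' ω (j + 1), mul_assoc, aux_leib ξ ω hω, ih, hc, mul_add, mul_smul_comm,
      ← mul_assoc ω, ← pow_succ' ω j, ← mul_assoc ω, ← add_assoc]
    congr 1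
    push_cast
    rw [add_smul ((j : ℂ) + 1) (1 : ℂ), one_smul, add_comm]

theorem aux_deg {M : Type*} [AddCommGroup M] [Module ℂ M] (ξ : Module.Dual ℂ M) (i : ℕ) :
    ∀ x ∈ extGrade M (i + 1), CliffordAlgebra.contractLeft ξ x ∈ extGrade M i := by
  induction i with
  | zero =>
    intro x hx
    unfold extGrade at hx ⊢
    rw [zero_add, pow_one] at hx
    obtain ⟨a, rfl⟩ := hx
    rw [CliffordAlgebra.contractLeft_ι, pow_zero]
    exact Submodule.algebraMap_mem _
  | succ i ih =>
    intro x hx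
    unfold extGrade at hx ih ⊢
    rw [pow_succ'] at hx
    induction hx using Submodule.mul_induction_on' with
    | mem_mul_mem m hm y hy =>
      have hy' := ih y hy
      obtain ⟨a, rfl⟩ := hm
      rw [CliffordAlgebra.contractLeft_ι_mul]
      refine Submodule.sub_mem _ (Submodule.smul_mem _ _ hy) ?_
      rw [pow_succ']
      exact Submodule.mul_mem_mul ⟨a, rfl⟩ hy'
    | add u _ v _ hu hv =>
      rw [map_add]
      exact Submodule.add_mem _ hu hv

theorem aux_deg0 {M : Type*} [AddCommGroup M] [Module ℂ M] (ξ : Module.Dual ℂ M) :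
    ∀ x ∈ extGrade M 0, CliffordAlgebra.contractLeft ξ x = 0 := by
  intro x hx
  unfold extGrade at hx
  rw [pow_zero] at hx
  obtain ⟨r, rfl⟩ := Submodule.mem_one.mp hx
  exact CliffordAlgebra.contractLeft_algebraMap _ _ _

theorem aux_mul {M : Type*} [AddCommGroup M] [Module ℂ M] {i j l : ℕ}
    (h : i + j = l) {x y : ExteriorAlgebra ℂ M} (hx : x ∈ extGrade M i) (hy : y ∈ extGrade M j) :
    x * y ∈ extGrade M l := by
  subst h
  unfold extGrade at *
  rw [pow_add]
  exact Submodule.mul_mem_mul hx hy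

/-- Work in the exterior algebra over the space `M` of `1`-forms of a
`2n`-dimensional vector space, with nondegenerate `2`-form `ω` (the Kähler form),
`ξ ∈ Module.Dual ℂ M` the contraction datum and `θ = −ι_ξ ω`.  Let `w` be the Weil element of
the `sl₂(ℂ)`-representation determined by the Lefschetz operator `ω∧`, characterized on the
Lefschetz pieces by `w((1/j!)·ω^j ∧ α) = ((−1)^j/(k−j)!)·ω^{k−j} ∧ α` for `α` primitive of
codegree `k` and `0 ≤ j ≤ k`.  Then `w` exchanges contraction with `ξ` and wedge product
with `θ`:  `w(ι_ξ α') = θ ∧ w(α')` for every element `α' = (1/j!)·ω^j ∧ α` of the Lefschetz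
decomposition. -/
theorem stmt12 {M : Type*} [AddCommGroup M] [Module ℂ M]
    (n : ℕ) (ξ : Module.Dual ℂ M)
    (ω : ExteriorAlgebra ℂ M) (hω : ω ∈ extGrade M 2)
    (w : ExteriorAlgebra ℂ M →ₗ[ℂ] ExteriorAlgebra ℂ M)
    (hw : ∀ (k j : ℕ), j ≤ k → k ≤ n →
      ∀ α ∈ extGrade M (n - k), ω ^ (k + 1) * α = 0 →
        w (((j.factorial : ℂ))⁻¹ • (ω ^ j * α))
          = ((-1 : ℂ) ^ j * (((k - j).factorial : ℂ))⁻¹) • (ω ^ (k - j) * α))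
    (k j : ℕ) (hjk : j ≤ k) (hkn : k ≤ n)
    (α : ExteriorAlgebra ℂ M) (hα : α ∈ extGrade M (n - k))
    (hαprim : ω ^ (k + 1) * α = 0) :
    w (CliffordAlgebra.contractLeft ξ (((j.factorial : ℂ))⁻¹ • (ω ^ j * α)))
      = (-(CliffordAlgebra.contractLeft ξ ω)) * w (((j.factorial : ℂ))⁻¹ • (ω ^ j * α)) := by
  obtain ⟨θ, hθ⟩ : ∃ θ, θ = -(CliffordAlgebra.contractLeft ξ ω) := ⟨_, rfl⟩
  have hθ' : CliffordAlgebra.contractLeft ξ ω = -θ := by rw [hθ, neg_neg]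
  have hθ1 : θ ∈ extGrade M 1 := by
    rw [hθ]; exact Submodule.neg_mem _ (aux_deg ξ 1 ω hω)
  have hk1 : ((k : ℂ) + 1) ≠ 0 := Nat.cast_add_one_ne_zero k
  obtain ⟨γ₁, hγ₁⟩ : ∃ γ₁, γ₁ = ((k : ℂ) + 1)⁻¹ • CliffordAlgebra.contractLeft ξ α := ⟨_, rfl⟩
  have hια : CliffordAlgebra.contractLeft ξ α = ((k : ℂ) + 1) • γ₁ := by
    rw [hγ₁, smul_inv_smul₀ hk1]
  obtain ⟨γ₀, hγ₀⟩ : ∃ γ₀, γ₀ = θ * α - ω * γ₁ := ⟨_, rfl⟩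
  have hdec : θ * α = γ₀ + ω * γ₁ := by rw [hγ₀]; abel
  -- the primitive condition on the lower component
  have hp0 : ω ^ k * γ₀ = 0 := by
    have h := aux_leib_pow ξ ω hω α k
    rw [hαprim, map_zero, hθ', hια, neg_mul, hdec, mul_smul_comm, mul_neg, smul_neg, mul_add,
      ← mul_assoc, ← pow_succ, smul_add, neg_add, add_assoc, neg_add_cancel, add_zero] at h
    have h2 := neg_eq_zero.mp h.symm
    exact (smul_eq_zero.mp h2).resolve_left hk1
  have hp1 : ω ^ (k + 2) * γ₁ = 0 := by
    have hc : ω ^ (k + 1) * (θ * α) = 0 := by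
      rw [← mul_assoc, ((show Commute ω θ from aux_comm ω hω _).pow_left (k + 1)).eq, mul_assoc,
        hαprim, mul_zero]
    rw [hdec, mul_add, pow_succ', mul_assoc ω _ γ₀, hp0, mul_zero, zero_add, ← pow_succ',
      ← mul_assoc, ← pow_succ] at hc
    exact hc
  -- action of w on the upper component
  have hw1 : w (((k : ℂ) + 1 - j) • ((j.factorial : ℂ)⁻¹ • (ω ^ j * γ₁)))
      = ((-1 : ℂ) ^ j * (((k - j).factorial : ℂ))⁻¹) • (ω ^ (k - j + 1) * γ₁) := by
    rcases Nat.lt_or_ge k n with hlt | hge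
    · have hd : γ₁ ∈ extGrade M (n - (k + 1)) := by
        rw [hγ₁]
        refine Submodule.smul_mem _ _ (aux_deg ξ _ α ?_)
        rwa [show n - (k + 1) + 1 = n - k by omega]
      rw [map_smul, hw (k + 1) j (by omega) (by omega) γ₁ hd hp1, smul_smul,
        show k + 1 - j = k - j + 1 by omega]
      congr 1
      have e : ((k : ℂ) + 1 - j) = ((k - j : ℕ) : ℂ) + 1 := by
        rw [Nat.cast_sub hjk]; ring
      rw [e, Nat.factorial_succ]
      have h1 : (((k - j : ℕ) : ℂ) + 1) ≠ 0 := Nat.cast_add_one_ne_zero _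
      have h2 : ((k - j).factorial : ℂ) ≠ 0 := Nat.cast_ne_zero.mpr (Nat.factorial_ne_zero _)
      push_cast [-Nat.cast_sub]
      field_simp
    · have : γ₁ = 0 := by
        rw [hγ₁, aux_deg0 ξ α (by rwa [show n - k = 0 by omega] at hα), smul_zero]
      simp [this]
  have hR : θ * w (((j.factorial : ℂ))⁻¹ • (ω ^ j * α))
      = ((-1 : ℂ) ^ j * (((k - j).factorial : ℂ))⁻¹) • (ω ^ (k - j) * γ₀)
        + ((-1 : ℂ) ^ j * (((k - j).factorial : ℂ))⁻¹) • (ω ^ (k - j + 1) * γ₁) := by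
    rw [hw k j hjk hkn α hα hαprim, mul_smul_comm, ← mul_assoc,
      ← ((show Commute ω θ from aux_comm ω hω _).pow_left (k - j)).eq, mul_assoc, hdec, mul_add,
      smul_add, ← mul_assoc, ← pow_succ]
  rw [← hθ, hR, ← hw1]
  cases j with
  | zero =>
    simp only [Nat.sub_zero, hp0, smul_zero, zero_add]
    simp [hια]
  | succ i =>
    have hd0 : γ₀ ∈ extGrade M (n - (k - 1)) := by
      rcases Nat.lt_or_ge k n with hlt | hge
      · rw [hγ₀]
        refine Submodule.sub_mem _ (aux_mul (by omega) hθ1 hα) ?_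
        refine aux_mul (i := 2) (j := n - (k + 1)) (by omega) hω ?_
        rw [hγ₁]
        refine Submodule.smul_mem _ _ (aux_deg ξ _ α ?_)
        rwa [show n - (k + 1) + 1 = n - k by omega]
      · have : γ₁ = 0 := by
          rw [hγ₁, aux_deg0 ξ α (by rwa [show n - k = 0 by omega] at hα), smul_zero]
        rw [hγ₀, this, mul_zero, sub_zero]
        exact aux_mul (by omega) hθ1 hα
    have hw0 := hw (k - 1) i (by omega) (by omega) γ₀ hd0
      (by rwa [show k - 1 + 1 = k by omega])
    rw [show k - 1 - i = k - (i + 1) by omega] at hw0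
    have hL : CliffordAlgebra.contractLeft ξ (((i + 1).factorial : ℂ)⁻¹ • (ω ^ (i + 1) * α))
        = -((i.factorial : ℂ)⁻¹ • (ω ^ i * γ₀))
          + ((k : ℂ) + 1 - (i + 1 : ℕ)) • (((i + 1).factorial : ℂ)⁻¹ • (ω ^ (i + 1) * γ₁)) := by
      rw [map_smul, aux_leib_pow ξ ω hω, hθ', hια, neg_mul, hdec, mul_neg, mul_add,
        ← mul_assoc (ω ^ i) ω, ← pow_succ, mul_smul_comm, Nat.factorial_succ]
      have h1 : ((i : ℂ) + 1) ≠ 0 := Nat.cast_add_one_ne_zero _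
      have h2 : (i.factorial : ℂ) ≠ 0 := Nat.cast_ne_zero.mpr (Nat.factorial_ne_zero _)
      push_cast
      match_scalars <;> field_simp <;> ring
    rw [hL, map_add, map_neg, hw0]
    congr 1
    rw [← neg_smul]
    congr 1
    ring
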